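/- Let H be a complex Hilbert space and B a bounded self-adjoint operator on H. Let ζ ∈ ℂ, r > 0, λ ∈ ℝ with |λ − ζ| ≤ r, and λ_N ∈ σ(B) with |λ_N − ζ| ≤ r, and suppose that every μ ∈ σ(B) with μ ≠ λ_N satisfies |μ − ζ| > 9r. Let P be the Riesz projection of B over the circle of radius 2r centered at ζ. Then for every φ ∈ H, ‖φ − Pφ‖ ≤ (4/r)·‖λ·φ − Bφ‖. -/

import Mathlib

/-- The Riesz projection of a bounded operator `B` over the positively oriented circle of
radius `R` centered at `c`: `(2πi)⁻¹ ∮_{|z-c|=R} (z•I - B)⁻¹ dz`, where the inverse is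
interpreted as `0` at points where `z•I - B` is not invertible. -/
noncomputable def rieszProjection {H : Type*} [NormedAddCommGroup H] [InnerProductSpace ℂ H]
    [CompleteSpace H] (B : H →L[ℂ] H) (c : ℂ) (R : ℝ) : H →L[ℂ] H :=
  (2 * Real.pi * Complex.I : ℂ)⁻¹ • ∮ z in C(c, R), Ring.inverse (z • (1 : H →L[ℂ] H) - B)

theorem aux_res {H : Type*} [NormedAddCommGroup H] [InnerProductSpace ℂ H] [CompleteSpace H]
    (B : H →L[ℂ] H) (hB : IsSelfAdjoint B) (z : ℂ) (d : ℝ) (hd : 0 < d)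
    (h : ∀ μ ∈ spectrum ℂ B, d ≤ ‖z - μ‖) :
    IsUnit (z • (1 : H →L[ℂ] H) - B) ∧ ‖Ring.inverse (z • (1 : H →L[ℂ] H) - B)‖ ≤ d⁻¹ := by
  have hz : z ∉ spectrum ℂ B := fun hz => by
    have := h z hz
    simp at this
    linarith
  have hu : IsUnit (z • (1 : H →L[ℂ] H) - B) := by
    rw [spectrum.notMem_iff, Algebra.algebraMap_eq_smul_one] at hz
    exact hz
  refine ⟨hu, ?_⟩
  obtain ⟨u, hu⟩ := hu
  rw [← hu, Ring.inverse_unit]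
  have hn : IsStarNormal (u : H →L[ℂ] H) := by
    rw [hu]
    constructor
    rw [star_sub, hB.star_eq, star_smul, star_one]
    change (_ - _) * (_ - _) = (_ - _) * (_ - _)
    simp only [sub_mul, mul_sub, smul_mul_assoc, mul_smul_comm, one_mul, mul_one]
    rw [smul_sub, smul_sub, smul_comm]
    abel
  have h1 := IsStarNormal.spectralRadius_eq_nnnorm (↑u⁻¹ : H →L[ℂ] H)
  have h2 : spectralRadius ℂ (↑u⁻¹ : H →L[ℂ] H) ≤ ((d⁻¹).toNNReal : ENNReal) := by
    refine iSup₂_le fun k hk => ?_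
    rw [← spectrum.map_inv, hu, ← Algebra.algebraMap_eq_smul_one, ← spectrum.singleton_sub_eq] at hk
    obtain ⟨w, hw, μ, hμ, hk⟩ := hk
    rw [Set.mem_singleton_iff] at hw
    subst hw
    have h3 := h μ hμ
    have : k = (w - μ)⁻¹ := by rw [← inv_inv k, ← hk]
    refine ENNReal.coe_le_coe.2 ?_
    rw [← NNReal.coe_le_coe, Real.coe_toNNReal _ (by positivity)]
    change ‖k‖ ≤ d⁻¹
    rw [this, norm_inv]
    gcongr
  rw [h1] at h2
  have h4 := NNReal.coe_le_coe.2 (ENNReal.coe_le_coe.1 h2)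
  rwa [Real.coe_toNNReal _ (by positivity)] at h4

theorem stmt17 {H : Type*} [NormedAddCommGroup H] [InnerProductSpace ℂ H] [CompleteSpace H]
    (B : H →L[ℂ] H) (hB : IsSelfAdjoint B) (ζ : ℂ) (r : ℝ) (hr : 0 < r)
    (lam : ℝ) (hlam : ‖(lam : ℂ) - ζ‖ ≤ r)
    (lamN : ℂ) (hlamN : lamN ∈ spectrum ℂ B) (hlamNζ : ‖lamN - ζ‖ ≤ r)
    (hsep : ∀ μ ∈ spectrum ℂ B, μ ≠ lamN → 9 * r < ‖μ - ζ‖) :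
    ∀ φ : H, ‖φ - rieszProjection B ζ (2 * r) φ‖ ≤ (4 / r) * ‖(lam : ℂ) • φ - B φ‖ := by
  intro φ
  have hR : (0:ℝ) ≤ 2 * r := by linarith
  have key : ∀ z ∈ Metric.sphere ζ (2 * r), IsUnit (z • (1 : H →L[ℂ] H) - B) ∧
      ‖Ring.inverse (z • (1 : H →L[ℂ] H) - B)‖ ≤ r⁻¹ := by
    intro z hz
    rw [mem_sphere_iff_norm] at hz
    refine aux_res B hB z r hr fun μ hμ => ?_
    by_cases h : μ = lamN
    · subst h
      have := norm_sub_le_norm_sub_add_norm_sub z μ ζ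
      linarith
    · have h1 := hsep μ hμ h
      have h2 := norm_sub_le_norm_sub_add_norm_sub μ z ζ
      rw [norm_sub_rev μ z] at h2
      linarith
  have hl : ∀ z ∈ Metric.sphere ζ (2 * r), r ≤ ‖z - lam‖ := by
    intro z hz
    rw [mem_sphere_iff_norm] at hz
    have := norm_sub_le_norm_sub_add_norm_sub z lam ζ
    linarith
  have hfc : ContinuousOn (fun z : ℂ => Ring.inverse (z • (1 : H →L[ℂ] H) - B))
      (Metric.sphere ζ (2 * r)) := by
    intro z hz
    obtain ⟨u, hu⟩ := (key z hz).1
    have h1 := NormedRing.inverse_continuousAt u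
    rw [hu] at h1
    have h2 : ContinuousAt (fun z : ℂ => z • (1 : H →L[ℂ] H) - B) z := by fun_prop
    exact (ContinuousAt.comp (f := fun z : ℂ => z • (1 : H →L[ℂ] H) - B) h1 h2).continuousWithinAt
  have hfi := hfc.circleIntegrable hR
  have hfci : ContinuousOn (fun z : ℂ => Ring.inverse (z • (1 : H →L[ℂ] H) - B) φ)
      (Metric.sphere ζ (2 * r)) := hfc.clm_apply continuousOn_const
  have happ : (∮ z in C(ζ, 2 * r), Ring.inverse (z • (1 : H →L[ℂ] H) - B)) φ
      = ∮ z in C(ζ, 2 * r), Ring.inverse (z • (1 : H →L[ℂ] H) - B) φ := by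
    have := ContinuousLinearMap.intervalIntegral_comp_comm
      (ContinuousLinearMap.apply ℂ H φ) hfi.out
    simp only [circleIntegral]
    simpa using this.symm
  have hgc : ContinuousOn (fun z : ℂ => (z - (lam:ℂ))⁻¹ • φ) (Metric.sphere ζ (2 * r)) := by
    refine ContinuousOn.smul (ContinuousOn.inv₀ (by fun_prop) ?_) continuousOn_const
    intro z hz h0
    have := hl z hz
    rw [h0, norm_zero] at this
    linarith
  have hg : (2 * Real.pi * Complex.I : ℂ)⁻¹ • (∮ z in C(ζ, 2 * r), (z - (lam:ℂ))⁻¹ • φ) = φ := by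
    rw [circleIntegral.integral_smul_const, circleIntegral.integral_sub_inv_of_mem_ball, smul_smul,
      inv_mul_cancel₀ Complex.two_pi_I_ne_zero, one_smul]
    rw [mem_ball_iff_norm]
    linarith
  have e : φ - rieszProjection B ζ (2 * r) φ = (2 * Real.pi * Complex.I : ℂ)⁻¹ •
      ∮ z in C(ζ, 2 * r), ((z - (lam:ℂ))⁻¹ • φ - Ring.inverse (z • (1 : H →L[ℂ] H) - B) φ) := by
    rw [circleIntegral.integral_sub (hgc.circleIntegrable hR) (hfci.circleIntegrable hR),
      smul_sub, hg, ← happ]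
    rfl
  rw [e]
  have hb := circleIntegral.norm_two_pi_i_inv_smul_integral_le_of_norm_le_const
    (f := fun z : ℂ => (z - (lam:ℂ))⁻¹ • φ - Ring.inverse (z • (1 : H →L[ℂ] H) - B) φ)
    (c := ζ) (R := 2 * r) (C := r⁻¹ * (r⁻¹ * ‖(lam : ℂ) • φ - B φ‖)) hR ?_
  · refine hb.trans ?_
    have : 2 * r * (r⁻¹ * (r⁻¹ * ‖(lam : ℂ) • φ - B φ‖)) = (2 / r) * ‖(lam : ℂ) • φ - B φ‖ := by
      field_simp
    rw [this]
    gcongr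
    norm_num
  · intro z hz
    obtain ⟨h1, h2⟩ := key z hz
    have h3 := hl z hz
    have hne : z - (lam:ℂ) ≠ 0 := fun h0 => by
      rw [h0, norm_zero] at h3
      linarith
    have e1 : ∀ x : H, Ring.inverse (z • (1 : H →L[ℂ] H) - B) (z • x - B x) = x := by
      intro x
      have := congrArg (fun T : H →L[ℂ] H => T x) (Ring.inverse_mul_cancel _ h1)
      simpa using this
    have e2 : (z - (lam:ℂ))⁻¹ • φ - Ring.inverse (z • (1 : H →L[ℂ] H) - B) φ
        = (z - (lam:ℂ))⁻¹ • Ring.inverse (z • (1 : H →L[ℂ] H) - B) ((lam : ℂ) • φ - B φ) := by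
      have : (lam : ℂ) • φ - B φ = (z • φ - B φ) - (z - (lam:ℂ)) • φ := by
        rw [sub_smul]; abel
      rw [this, map_sub, e1, map_smul, smul_sub, smul_smul, inv_mul_cancel₀ hne, one_smul]
    simp only [e2]
    rw [norm_smul, norm_inv]
    gcongr
    exact ContinuousLinearMap.le_of_opNorm_le _ h2 _
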